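/- Fix an integer d ≥ 2 and σ > 0, and let the noise distribution be Gaussian, ν = N(0,σ²). There exists a constant C₁₇ > 0, depending only on d and σ, such that for every integer n ≥ 125 and every set estimator Ĉ based on n observations: sup_{C ∈ 𝒞_d} E_{μ_C^{⊗n}}[ |C △ Ĉ| ] ≥ C₁₇ n^{−2/(d+1)}. -/

import Mathlib

open MeasureTheory Set Real Pointwise ProbabilityTheory

noncomputable section

/-- The unit cube `[0,1]^d`. -/
def cube (d : ℕ) : Set (EuclideanSpace ℝ (Fin d)) := {x | ∀ i, x i ∈ Set.Icc (0:ℝ) 1}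

/-- Volume of the unit Euclidean ball in dimension `d`. -/
def unitBallVol (d : ℕ) : ℝ :=
  (volume (Metric.closedBall (0 : EuclideanSpace ℝ (Fin d)) 1)).toReal

/-- Law of one observation `(X, 1_G(X) + ξ)`. -/
def regMeasure (d : ℕ) (ν : Measure ℝ) (G : Set (EuclideanSpace ℝ (Fin d))) :
    Measure (EuclideanSpace ℝ (Fin d) × ℝ) :=
  Measure.map (fun p => (p.1, G.indicator (fun _ => (1:ℝ)) p.1 + p.2))
    ((volume.restrict (cube d)).prod ν)

/-- Law of `n` i.i.d. observations. -/
def sampleLaw (d n : ℕ) (ν : Measure ℝ) (G : Set (EuclideanSpace ℝ (Fin d))) :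
    Measure (Fin n → EuclideanSpace ℝ (Fin d) × ℝ) :=
  Measure.pi (fun _ => regMeasure d ν G)

/-- Assumption A : σ-subgaussian noise. -/
def SubGaussian (ν : Measure ℝ) (σ : ℝ) : Prop :=
  ∀ u : ℝ, ∫ t, Real.exp (u * t) ∂ν ≤ Real.exp (u^2 * σ^2 / 2)

/-- Polytopes in `[0,1]^d` with at most `r` vertices. -/
def polytopes (d r : ℕ) : Set (Set (EuclideanSpace ℝ (Fin d))) :=
  {P | ∃ V : Finset (EuclideanSpace ℝ (Fin d)), V.card ≤ r ∧ ↑V ⊆ cube d ∧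
    P = convexHull ℝ (V : Set (EuclideanSpace ℝ (Fin d)))}

/-- Polytopes in `[0,1]^d` with at most `r` vertices whose coordinates are
integer multiples of `1/n`. -/
def gridPolytopes (d r n : ℕ) : Set (Set (EuclideanSpace ℝ (Fin d))) :=
  {P | ∃ V : Finset (EuclideanSpace ℝ (Fin d)), V.card ≤ r ∧ ↑V ⊆ cube d ∧
    (∀ v ∈ V, ∀ i, ∃ k : ℤ, v i = k / n) ∧
    P = convexHull ℝ (V : Set (EuclideanSpace ℝ (Fin d)))}

/-- Compact convex subsets of `[0,1]^d`. -/
def convexSets (d : ℕ) : Set (Set (EuclideanSpace ℝ (Fin d))) :=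
  {C | Convex ℝ C ∧ IsCompact C ∧ C ⊆ cube d}

/-- Least squares criterion. -/
def crit {d n : ℕ} (P : Set (EuclideanSpace ℝ (Fin d)))
    (ω : Fin n → EuclideanSpace ℝ (Fin d) × ℝ) : ℝ :=
  ∑ i, (1 - 2 * (ω i).2) * P.indicator (fun _ => (1:ℝ)) (ω i).1

/-- `hatP` is a least squares estimator over `𝒫_r^{(n)}`. -/
def IsLSE (d r n : ℕ)
    (hatP : (Fin n → EuclideanSpace ℝ (Fin d) × ℝ) → Set (EuclideanSpace ℝ (Fin d))) :
    Prop :=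
  (∀ ω, hatP ω ∈ gridPolytopes d r n ∧ ∀ Q ∈ gridPolytopes d r n, crit (hatP ω) ω ≤ crit Q ω)
  ∧ Measurable (fun p : (EuclideanSpace ℝ (Fin d)) × (Fin n → EuclideanSpace ℝ (Fin d) × ℝ) =>
      (hatP p.2).indicator (fun _ => (1:ℝ)) p.1)

/-- A set estimator : measurable set-valued map with values Borel subsets of the cube. -/
def IsSetEstimator (d n : ℕ)
    (hatG : (Fin n → EuclideanSpace ℝ (Fin d) × ℝ) → Set (EuclideanSpace ℝ (Fin d))) :
    Prop :=
  (∀ ω, hatG ω ⊆ cube d ∧ MeasurableSet (hatG ω))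
  ∧ Measurable (fun p : (EuclideanSpace ℝ (Fin d)) × (Fin n → EuclideanSpace ℝ (Fin d) × ℝ) =>
      (hatG p.2).indicator (fun _ => (1:ℝ)) p.1)

/-- Nikodym (pseudo-)distance : Lebesgue measure of the symmetric difference. -/
def sdVol {d : ℕ} (G₁ G₂ : Set (EuclideanSpace ℝ (Fin d))) : ℝ :=
  (volume (symmDiff G₁ G₂)).toReal

lemma volume_cube (d : ℕ) : volume (cube d) = 1 := by
  have h : cube d = (WithLp.ofLp : EuclideanSpace ℝ (Fin d) → Fin d → ℝ) ⁻¹' Icc 0 1 := by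
    ext x
    simp [cube, Pi.le_def, forall_and]
  rw [h, (PiLp.volume_preserving_ofLp (Fin d)).measure_preimage measurableSet_Icc.nullMeasurableSet,
    Real.volume_Icc_pi]
  simp

lemma isClosed_cube (d : ℕ) : IsClosed (cube d) := by
  simp only [cube, ofPred_forall]
  exact isClosed_iInter fun i => isClosed_Icc.preimage (by fun_prop)

lemma isCompact_cube (d : ℕ) : IsCompact (cube d) := by
  refine Metric.isCompact_of_isClosed_isBounded (isClosed_cube d) ?_
  have h : cube d = (WithLp.ofLp : EuclideanSpace ℝ (Fin d) → Fin d → ℝ) ⁻¹' Icc 0 1 := by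
    ext x
    simp [cube, Pi.le_def, forall_and]
  rw [h]
  exact (PiLp.antilipschitzWith_ofLp 2 (fun _ : Fin d => ℝ)).isBounded_preimage
    (Metric.isBounded_Icc _ _)

instance isProbabilityMeasure_restrict_cube (d : ℕ) :
    IsProbabilityMeasure (volume.restrict (cube d)) :=
  ⟨by simp [volume_cube]⟩

lemma measurable_response {d : ℕ} {G : Set (EuclideanSpace ℝ (Fin d))} (hG : MeasurableSet G) :
    Measurable (fun p : EuclideanSpace ℝ (Fin d) × ℝ =>
      (p.1, G.indicator (fun _ => (1:ℝ)) p.1 + p.2)) :=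
  measurable_fst.prodMk
    (((measurable_const.indicator hG).comp measurable_fst).add measurable_snd)

lemma isProbabilityMeasure_regMeasure {d : ℕ} {ν : Measure ℝ} [IsProbabilityMeasure ν]
    {G : Set (EuclideanSpace ℝ (Fin d))} (hG : MeasurableSet G) :
    IsProbabilityMeasure (regMeasure d ν G) :=
  Measure.isProbabilityMeasure_map (measurable_response hG).aemeasurable

/-- Observations whose design point avoids `G₁ ∆ G₂` do not distinguish `G₁` from `G₂`. -/
lemma regMeasure_restrict_compl_symmDiff {d : ℕ} {ν : Measure ℝ} [IsProbabilityMeasure ν]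
    {G₁ G₂ : Set (EuclideanSpace ℝ (Fin d))} (h₁ : MeasurableSet G₁) (h₂ : MeasurableSet G₂) :
    (regMeasure d ν G₁).restrict ((symmDiff G₁ G₂)ᶜ ×ˢ univ) =
      (regMeasure d ν G₂).restrict ((symmDiff G₁ G₂)ᶜ ×ˢ univ) := by
  have hS : MeasurableSet ((symmDiff G₁ G₂)ᶜ ×ˢ (univ : Set ℝ)) :=
    (h₁.symmDiff h₂).compl.prod .univ
  unfold regMeasure
  rw [Measure.restrict_map (measurable_response h₁) hS,
    Measure.restrict_map (measurable_response h₂) hS]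
  refine Measure.map_congr ?_
  refine (ae_restrict_iff' ((measurable_response h₁) hS)).2 (.of_forall fun p hp => ?_)
  have hp' : p.1 ∉ symmDiff G₁ G₂ := hp.1
  have : p.1 ∈ G₁ ↔ p.1 ∈ G₂ := by
    rw [mem_symmDiff] at hp'
    tauto
  by_cases hh : p.1 ∈ G₂ <;> simp [this, hh]

lemma regMeasure_prod_univ {d : ℕ} {ν : Measure ℝ} [IsProbabilityMeasure ν]
    {G A : Set (EuclideanSpace ℝ (Fin d))} (hG : MeasurableSet G) (hA : MeasurableSet A) :
    regMeasure d ν G (A ×ˢ univ) = volume (A ∩ cube d) := by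
  have : (fun p : EuclideanSpace ℝ (Fin d) × ℝ =>
      (p.1, G.indicator (fun _ => (1:ℝ)) p.1 + p.2)) ⁻¹' (A ×ˢ univ) = A ×ˢ univ := by
    ext p; simp
  rw [regMeasure, Measure.map_apply (measurable_response hG) (hA.prod .univ), this,
    Measure.prod_prod, Measure.restrict_apply hA]
  simp

lemma IsSetEstimator.measurable_volume {d n : ℕ}
    {hatC : (Fin n → EuclideanSpace ℝ (Fin d) × ℝ) → Set (EuclideanSpace ℝ (Fin d))}
    (h : IsSetEstimator d n hatC) {C D : Set (EuclideanSpace ℝ (Fin d))}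
    (hC : MeasurableSet C) (hD : MeasurableSet D) :
    Measurable fun ω => volume (symmDiff C (hatC ω) ∩ D) := by
  have hS : MeasurableSet {p : EuclideanSpace ℝ (Fin d) ×
      (Fin n → EuclideanSpace ℝ (Fin d) × ℝ) | p.1 ∈ hatC p.2} := by
    convert h.2 (measurableSet_singleton (1:ℝ)) using 1
    ext p
    simp [indicator]
  exact measurable_measure_prodMk_right (((measurable_fst hC).symmDiff hS).inter (measurable_fst hD))

/-- Le Cam's two-point bound, using that the two laws agree on the event that no design point falls
in the symmetric difference. -/
lemma two_point_bound {d n : ℕ} {ν : Measure ℝ} [IsProbabilityMeasure ν]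
    {hatC : (Fin n → EuclideanSpace ℝ (Fin d) × ℝ) → Set (EuclideanSpace ℝ (Fin d))}
    (h : IsSetEstimator d n hatC) {C₁ C₂ : Set (EuclideanSpace ℝ (Fin d))}
    (h₁ : MeasurableSet C₁) (h₂ : MeasurableSet C₂) :
    volume (symmDiff C₁ C₂) * (volume ((symmDiff C₁ C₂)ᶜ ∩ cube d)) ^ n ≤
      ∫⁻ ω, volume (symmDiff C₁ (hatC ω) ∩ symmDiff C₁ C₂) ∂ sampleLaw d n ν C₁ +
      ∫⁻ ω, volume (symmDiff C₂ (hatC ω) ∩ symmDiff C₁ C₂) ∂ sampleLaw d n ν C₂ := by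
  have := isProbabilityMeasure_regMeasure (ν := ν) h₁
  have := isProbabilityMeasure_regMeasure (ν := ν) h₂
  set D := symmDiff C₁ C₂ with hDdef
  have hD : MeasurableSet D := h₁.symmDiff h₂
  set A : Set (Fin n → EuclideanSpace ℝ (Fin d) × ℝ) := univ.pi fun _ => Dᶜ ×ˢ univ
  have hA : (sampleLaw d n ν C₁).restrict A = (sampleLaw d n ν C₂).restrict A := by
    simp only [sampleLaw, A, Measure.restrict_pi_pi, D, regMeasure_restrict_compl_symmDiff h₁ h₂]
  have hAm : sampleLaw d n ν C₁ A = (volume (Dᶜ ∩ cube d)) ^ n := by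
    simp only [sampleLaw, A, Measure.pi_pi, regMeasure_prod_univ h₁ hD.compl]
    simp
  calc volume D * volume (Dᶜ ∩ cube d) ^ n
      = ∫⁻ _ in A, volume D ∂ sampleLaw d n ν C₁ := by rw [setLIntegral_const, hAm]
    _ ≤ ∫⁻ ω in A, volume (symmDiff C₁ (hatC ω) ∩ D) + volume (symmDiff C₂ (hatC ω) ∩ D)
          ∂ sampleLaw d n ν C₁ := by
        refine lintegral_mono fun ω => (measure_mono ?_).trans (measure_union_le _ _)
        intro x hx
        have hx' := hx
        rw [hDdef] at hx'
        simp only [mem_union, mem_inter_iff, hx, and_true]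
        simp only [mem_symmDiff] at hx' ⊢
        tauto
    _ = ∫⁻ ω in A, volume (symmDiff C₁ (hatC ω) ∩ D) ∂ sampleLaw d n ν C₁ +
          ∫⁻ ω in A, volume (symmDiff C₂ (hatC ω) ∩ D) ∂ sampleLaw d n ν C₂ := by
        rw [lintegral_add_left (h.measurable_volume h₁ hD), hA]
    _ ≤ _ := add_le_add (setLIntegral_le_lintegral _ _) (setLIntegral_le_lintegral _ _)

/-- Assouad's lemma for a family of sets indexed by a hypercube, in which flipping one coordinate
changes the set exactly on one of the pairwise disjoint sets `D j`. -/
lemma assouad_bound {d n : ℕ} {ν : Measure ℝ} [IsProbabilityMeasure ν]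
    {hatC : (Fin n → EuclideanSpace ℝ (Fin d) × ℝ) → Set (EuclideanSpace ℝ (Fin d))}
    (h : IsSetEstimator d n hatC) {J : Type*} [Fintype J] [DecidableEq J]
    {C : (J → Bool) → Set (EuclideanSpace ℝ (Fin d))} {D : J → Set (EuclideanSpace ℝ (Fin d))}
    (hC : ∀ w, MeasurableSet (C w)) (hdisj : Pairwise fun i j => Disjoint (D i) (D j))
    (hflip : ∀ w j, symmDiff (C w) (C (Function.update w j (!w j))) = D j)
    {L S : ENNReal} (hL : ∀ j, L ≤ volume (D j) * (volume ((D j)ᶜ ∩ cube d)) ^ n)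
    (hS : ∀ w, ∫⁻ ω, volume (symmDiff (C w) (hatC ω)) ∂ sampleLaw d n ν (C w) ≤ S) :
    Fintype.card J * L ≤ 2 * S := by
  have hD : ∀ j, MeasurableSet (D j) := fun j => by
    rw [← hflip (fun _ => true) j]
    exact (hC _).symmDiff (hC _)
  let f : J → (J → Bool) → ENNReal := fun j w =>
    ∫⁻ ω, volume (symmDiff (C w) (hatC ω) ∩ D j) ∂ sampleLaw d n ν (C w)
  have hsum : ∀ w, ∑ j, f j w ≤ S := fun w => by
    refine le_trans ?_ (hS w)
    simp only [f]
    rw [← lintegral_finsetSum _ fun j _ => h.measurable_volume (hC w) (hD j)]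
    refine lintegral_mono fun ω => ?_
    have hm : ∀ j, MeasurableSet (symmDiff (C w) (hatC ω) ∩ D j) := fun j =>
      ((hC w).symmDiff (h.1 ω).2).inter (hD j)
    rw [← tsum_fintype (L := .unconditional J), ← measure_iUnion
      (fun i j hij => (hdisj hij).mono inter_subset_right inter_subset_right) hm]
    exact measure_mono (iUnion_subset fun j => inter_subset_left)
  have hpair : ∀ j, ∑ _w : J → Bool, L ≤ 2 * ∑ w, f j w := fun j => by
    have hinv : Function.Involutive fun w : J → Bool => Function.update w j (!w j) := fun w => by
      simp
    have hre : ∑ w, f j (Function.update w j (!w j)) = ∑ w, f j w :=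
      Equiv.sum_comp hinv.toPerm (f j)
    rw [two_mul]
    nth_rewrite 2 [← hre]
    rw [← Finset.sum_add_distrib]
    refine Finset.sum_le_sum fun w _ => (hL j).trans ?_
    have := two_point_bound (ν := ν) h (hC w) (hC (Function.update w j (!w j)))
    rwa [hflip] at this
  have hN0 : (Fintype.card (J → Bool) : ENNReal) ≠ 0 := by simp
  have hNt : (Fintype.card (J → Bool) : ENNReal) ≠ ⊤ := ENNReal.natCast_ne_top _
  rw [← ENNReal.mul_le_mul_iff_right hN0 hNt]
  calc (Fintype.card (J → Bool) : ENNReal) * (Fintype.card J * L)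
      = ∑ _j : J, ∑ _w : J → Bool, L := by
        simp only [Finset.sum_const, Finset.card_univ, nsmul_eq_mul]
        ring
    _ ≤ ∑ j, 2 * ∑ w, f j w := Finset.sum_le_sum fun j _ => hpair j
    _ = 2 * ∑ w, ∑ j, f j w := by rw [← Finset.mul_sum, Finset.sum_comm]
    _ ≤ 2 * ∑ _w : J → Bool, S := by gcongr with w; exact hsum w
    _ = _ := by
        simp only [Finset.sum_const, Finset.card_univ, nsmul_eq_mul]
        ring

/-- Volume of the region of constant vertical thickness `h` above a graph. -/
lemma volume_graph_slab {k : ℕ} {φ : (Fin k → ℝ) → ℝ} (hφ : Measurable φ) {B : Set (Fin k → ℝ)}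
    (hB : MeasurableSet B) (h : ℝ) :
    volume {x : EuclideanSpace ℝ (Fin (k + 1)) | (fun i => x (Fin.succ i)) ∈ B ∧
      φ (fun i => x (Fin.succ i)) - h < x 0 ∧ x 0 ≤ φ (fun i => x (Fin.succ i))} =
      volume B * ENNReal.ofReal h := by
  let T : Set (ℝ × (Fin k → ℝ)) := {p | p.2 ∈ B ∧ φ p.2 - h < p.1 ∧ p.1 ≤ φ p.2}
  have hT : MeasurableSet T := by
    have h₁ : MeasurableSet {p : ℝ × (Fin k → ℝ) | φ p.2 - h < p.1} :=
      measurableSet_lt (by fun_prop) (by fun_prop)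
    have h₂ : MeasurableSet {p : ℝ × (Fin k → ℝ) | p.1 ≤ φ p.2} :=
      measurableSet_le (by fun_prop) (by fun_prop)
    exact (measurable_snd hB).inter (h₁.inter h₂)
  have hmp := (volume_preserving_piFinSuccAbove (fun _ : Fin (k + 1) => ℝ) 0).comp
    (PiLp.volume_preserving_ofLp (Fin (k + 1)))
  have hpre : {x : EuclideanSpace ℝ (Fin (k + 1)) | (fun i => x (Fin.succ i)) ∈ B ∧
      φ (fun i => x (Fin.succ i)) - h < x 0 ∧ x 0 ≤ φ (fun i => x (Fin.succ i))} =
      (MeasurableEquiv.piFinSuccAbove (fun _ : Fin (k + 1) => ℝ) 0 ∘ WithLp.ofLp) ⁻¹' T := by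
    ext x
    rfl
  rw [hpre, hmp.measure_preimage hT.nullMeasurableSet, Measure.volume_eq_prod,
    Measure.prod_apply_symm hT]
  have hslice : ∀ y : Fin k → ℝ, volume ((fun t : ℝ => (t, y)) ⁻¹' T) =
      B.indicator (fun _ => ENNReal.ofReal h) y := fun y => by
    by_cases hy : y ∈ B
    · have : (fun t : ℝ => (t, y)) ⁻¹' T = Ioc (φ y - h) (φ y) := by
        ext t
        simp [T, hy]
      rw [this, Real.volume_Ioc]
      simp [hy]
    · have : (fun t : ℝ => (t, y)) ⁻¹' T = ∅ := by
        ext t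
        simp [T, hy]
      rw [this]
      simp [hy]
  simp only [hslice]
  rw [lintegral_indicator_const hB, mul_comm]

lemma volume_box {k : ℕ} (a : Fin k → ℝ) {r : ℝ} :
    volume {y : Fin k → ℝ | ∀ i, |y i - a i| ≤ r} = ENNReal.ofReal (2 * r) ^ k := by
  have : {y : Fin k → ℝ | ∀ i, |y i - a i| ≤ r} =
      Icc (fun i => a i - r) (fun i => a i + r) := by
    ext y
    simp only [mem_ofPred_eq, mem_Icc, Pi.le_def, abs_le, ← forall_and]
    refine forall_congr' fun i => ?_
    constructor <;> rintro ⟨h, h'⟩ <;> constructor <;> linarith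
  rw [this, Real.volume_Icc_pi]
  have : ∀ i, a i + r - (a i - r) = 2 * r := fun i => by ring
  simp [this]

lemma measurableSet_box {k : ℕ} (a : Fin k → ℝ) (r : ℝ) :
    MeasurableSet {y : Fin k → ℝ | ∀ i, |y i - a i| ≤ r} := by
  simp only [ofPred_forall]
  exact MeasurableSet.iInter fun i => measurableSet_le (by fun_prop) (by fun_prop)

/-- Height of `x` relative to the paraboloid `x 0 = 1 - s * ∑ i, x i.succ ^ 2`. -/
def paraboloid {k : ℕ} (s : ℝ) (x : EuclideanSpace ℝ (Fin (k + 1))) : ℝ :=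
  x 0 + s * ∑ i : Fin k, x i.succ ^ 2 - 1

/-- Squared distance from the base point of `x` to `a`. -/
def baseDistSq {k : ℕ} (a : Fin k → ℝ) (x : EuclideanSpace ℝ (Fin (k + 1))) : ℝ :=
  ∑ i : Fin k, (x i.succ - a i) ^ 2

/-- The cap cut off from the paraboloid body above the ball of radius `δ` around `a`. -/
def cap {k : ℕ} (s δ : ℝ) (a : Fin k → ℝ) : Set (EuclideanSpace ℝ (Fin (k + 1))) :=
  {x | paraboloid s x ≤ 0 ∧ s * (baseDistSq a x - δ ^ 2) < paraboloid s x}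

/-- The paraboloid body inside the cube, without the caps with centre `a j` for which `w j` is
false. -/
def cappedBody {k : ℕ} {J : Type*} (s δ : ℝ) (a : J → Fin k → ℝ) (w : J → Bool) :
    Set (EuclideanSpace ℝ (Fin (k + 1))) :=
  {x | x ∈ cube (k + 1) ∧ paraboloid s x ≤ 0 ∧
    ∀ j, w j = false → paraboloid s x ≤ s * (baseDistSq (a j) x - δ ^ 2)}

lemma convex_cube (d : ℕ) : Convex ℝ (cube d) := by
  intro x hx y hy a b ha hb hab i
  exact convex_Icc (0:ℝ) 1 (hx i) (hy i) ha hb hab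

lemma convex_paraboloid {k : ℕ} {s : ℝ} (hs : 0 ≤ s) :
    Convex ℝ {x : EuclideanSpace ℝ (Fin (k + 1)) | paraboloid s x ≤ 0} := by
  intro x hx y hy a b ha hb hab
  simp only [mem_ofPred_eq, paraboloid, PiLp.add_apply, PiLp.smul_apply, smul_eq_mul] at *
  have h : ∑ i : Fin k, (a * x i.succ + b * y i.succ) ^ 2 ≤
      a * ∑ i : Fin k, x i.succ ^ 2 + b * ∑ i : Fin k, y i.succ ^ 2 := by
    rw [Finset.mul_sum, Finset.mul_sum, ← Finset.sum_add_distrib]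
    refine Finset.sum_le_sum fun i _ => ?_
    have hb' : b = 1 - a := by linarith
    subst hb'
    nlinarith [mul_nonneg (mul_nonneg ha hb) (sq_nonneg (x i.succ - y i.succ))]
  nlinarith [mul_le_mul_of_nonneg_left h hs, mul_le_mul_of_nonneg_left hx ha,
    mul_le_mul_of_nonneg_left hy hb]

lemma paraboloid_sub_baseDistSq {k : ℕ} (s : ℝ) (a : Fin k → ℝ)
    (x : EuclideanSpace ℝ (Fin (k + 1))) :
    paraboloid s x - s * baseDistSq a x =
      x 0 + ∑ i, 2 * s * a i * x i.succ - (1 + s * ∑ i, a i ^ 2) := by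
  have : baseDistSq a x = ∑ i : Fin k, x i.succ ^ 2 + ∑ i, a i ^ 2
      - ∑ i, 2 * a i * x i.succ := by
    rw [baseDistSq, ← Finset.sum_add_distrib, ← Finset.sum_sub_distrib]
    exact Finset.sum_congr rfl fun i _ => by ring
  have h2 : ∑ i, 2 * s * a i * x i.succ = s * ∑ i, 2 * a i * x i.succ := by
    rw [Finset.mul_sum]
    exact Finset.sum_congr rfl fun i _ => by ring
  rw [paraboloid, this, h2]
  ring

lemma convex_cap_cut {k : ℕ} (s δ : ℝ) (a : Fin k → ℝ) :
    Convex ℝ {x : EuclideanSpace ℝ (Fin (k + 1)) |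
      paraboloid s x ≤ s * (baseDistSq a x - δ ^ 2)} := by
  have : {x : EuclideanSpace ℝ (Fin (k + 1)) | paraboloid s x ≤ s * (baseDistSq a x - δ ^ 2)} =
      {x | x 0 + ∑ i, 2 * s * a i * x i.succ ≤ 1 + s * ∑ i, a i ^ 2 - s * δ ^ 2} := by
    ext x
    have := paraboloid_sub_baseDistSq s a x
    simp only [mem_ofPred_eq]
    constructor <;> intro h <;> nlinarith
  rw [this]
  refine convex_halfSpace_le ⟨fun x y => ?_, fun c x => ?_⟩ _
  · simp only [PiLp.add_apply, mul_add, Finset.sum_add_distrib]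
    ring
  · simp only [PiLp.smul_apply, smul_eq_mul, mul_add, Finset.mul_sum]
    congr 1
    exact Finset.sum_congr rfl fun i _ => by ring

lemma continuous_paraboloid {k : ℕ} (s : ℝ) :
    Continuous (paraboloid s : EuclideanSpace ℝ (Fin (k + 1)) → ℝ) := by
  unfold paraboloid
  fun_prop

lemma continuous_baseDistSq {k : ℕ} (a : Fin k → ℝ) :
    Continuous (baseDistSq a : EuclideanSpace ℝ (Fin (k + 1)) → ℝ) := by
  unfold baseDistSq
  fun_prop

lemma cappedBody_eq {k : ℕ} {J : Type*} (s δ : ℝ) (a : J → Fin k → ℝ) (w : J → Bool) :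
    cappedBody s δ a w = cube (k + 1) ∩ ({x | paraboloid s x ≤ 0} ∩
      ⋂ j, ⋂ _ : w j = false, {x | paraboloid s x ≤ s * (baseDistSq (a j) x - δ ^ 2)}) := by
  ext x
  simp only [cappedBody, mem_inter_iff, mem_ofPred_eq, mem_iInter]

lemma cappedBody_mem_convexSets {k : ℕ} {J : Type*} {s : ℝ} (hs : 0 ≤ s) (δ : ℝ)
    (a : J → Fin k → ℝ) (w : J → Bool) : cappedBody s δ a w ∈ convexSets (k + 1) := by
  rw [cappedBody_eq]
  refine ⟨(convex_cube _).inter ((convex_paraboloid hs).inter (convex_iInter fun j =>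
    convex_iInter fun _ => convex_cap_cut s δ (a j))), (isCompact_cube _).inter_right ?_,
    inter_subset_left⟩
  refine (isClosed_le (continuous_paraboloid s) continuous_const).inter
    (isClosed_iInter fun j => isClosed_iInter fun _ =>
      isClosed_le (continuous_paraboloid s) ?_)
  exact continuous_const.mul ((continuous_baseDistSq _).sub continuous_const)

lemma baseDistSq_lt_of_mem_cap {k : ℕ} {s δ : ℝ} (hs : 0 < s) {a : Fin k → ℝ}
    {x : EuclideanSpace ℝ (Fin (k + 1))} (hx : x ∈ cap s δ a) : baseDistSq a x < δ ^ 2 := by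
  have h : s * (baseDistSq a x - δ ^ 2) < 0 := hx.2.trans_le hx.1
  nlinarith

lemma abs_sub_lt_of_mem_cap {k : ℕ} {s δ : ℝ} (hs : 0 < s) (hδ : 0 < δ) {a : Fin k → ℝ}
    {x : EuclideanSpace ℝ (Fin (k + 1))} (hx : x ∈ cap s δ a) (i : Fin k) :
    |x i.succ - a i| < δ := by
  have h := baseDistSq_lt_of_mem_cap hs hx
  have h' : (x i.succ - a i) ^ 2 ≤ baseDistSq a x :=
    Finset.single_le_sum (f := fun i => (x (Fin.succ i) - a i) ^ 2)
      (fun i _ => sq_nonneg _) (Finset.mem_univ i)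
  exact abs_lt_of_sq_lt_sq (h'.trans_lt h) hδ.le

lemma le_baseDistSq_of_mem_cap {k : ℕ} {s δ : ℝ} (hs : 0 < s) (hδ : 0 < δ) {a b : Fin k → ℝ}
    {i : Fin k} (hab : 2 * δ ≤ |a i - b i|)
    {x : EuclideanSpace ℝ (Fin (k + 1))} (hx : x ∈ cap s δ a) : δ ^ 2 ≤ baseDistSq b x := by
  have h := abs_sub_lt_of_mem_cap hs hδ hx i
  have h' : (x i.succ - b i) ^ 2 ≤ baseDistSq b x :=
    Finset.single_le_sum (f := fun i => (x (Fin.succ i) - b i) ^ 2)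
      (fun i _ => sq_nonneg _) (Finset.mem_univ i)
  refine le_trans ?_ h'
  have : δ ≤ |x i.succ - b i| := by
    have := abs_sub_abs_le_abs_sub (a i - b i) (a i - x i.succ)
    rw [abs_sub_comm (a i) (x i.succ)] at this
    have e : a i - b i - (a i - x i.succ) = x i.succ - b i := by ring
    rw [e] at this
    linarith
  rw [← sq_abs (x i.succ - b i)]
  gcongr

lemma cap_disjoint {k : ℕ} {s δ : ℝ} (hs : 0 < s) (hδ : 0 < δ) {a b : Fin k → ℝ}
    {i : Fin k} (hab : 2 * δ ≤ |a i - b i|) : Disjoint (cap s δ a) (cap s δ b) :=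
  Set.disjoint_left.2 fun _ hx hy =>
    (baseDistSq_lt_of_mem_cap hs hy).not_ge (le_baseDistSq_of_mem_cap hs hδ hab hx)

lemma cap_subset_cube {k : ℕ} {δ : ℝ} (hδ : 0 < δ) (hδ1 : δ ≤ 1) {a : Fin k → ℝ}
    (ha : ∀ i, a i ∈ Icc δ (1 - δ)) : cap (1 / ((k:ℝ) + 1)) δ a ⊆ cube (k + 1) := by
  intro x hx
  have hs : (0:ℝ) < 1 / ((k:ℝ) + 1) := by positivity
  have hbase : ∀ i : Fin k, x i.succ ∈ Icc (0:ℝ) 1 := fun i => by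
    have h := abs_lt.1 (abs_sub_lt_of_mem_cap hs hδ hx i)
    have := ha i
    rw [mem_Icc] at this
    constructor <;> linarith
  have h0 : 0 ≤ ∑ i : Fin k, x i.succ ^ 2 := Finset.sum_nonneg fun i _ => sq_nonneg _
  have h1 : ∑ i : Fin k, x i.succ ^ 2 ≤ k := by
    calc ∑ i : Fin k, x i.succ ^ 2 ≤ ∑ _i : Fin k, (1:ℝ) :=
          Finset.sum_le_sum fun i _ => pow_le_one₀ (hbase i).1 (hbase i).2
      _ = k := by simp
  have hb : 0 ≤ baseDistSq a x := Finset.sum_nonneg fun i _ => sq_nonneg _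
  refine Fin.cases ?_ hbase
  obtain ⟨hx1, hx2⟩ := hx
  have hx1' : x 0 + 1 / ((k:ℝ) + 1) * ∑ i : Fin k, x i.succ ^ 2 - 1 ≤ 0 := hx1
  have hx2' : 1 / ((k:ℝ) + 1) * (baseDistSq a x - δ ^ 2) <
    x 0 + 1 / ((k:ℝ) + 1) * ∑ i : Fin k, x i.succ ^ 2 - 1 := hx2
  generalize hsdef : 1 / ((k:ℝ) + 1) = s at *
  have hsk : s * k + s = 1 := by rw [← hsdef]; field_simp
  constructor
  · have : δ ^ 2 ≤ 1 := pow_le_one₀ hδ.le hδ1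
    nlinarith [mul_le_mul_of_nonneg_left h1 hs.le, mul_nonneg hs.le hb]
  · nlinarith [mul_nonneg hs.le h0]

lemma symmDiff_cappedBody {k : ℕ} {J : Type*} [DecidableEq J] {s δ : ℝ} (hs : 0 < s)
    (hδ : 0 < δ) {a : J → Fin k → ℝ} (hsep : ∀ j j', j ≠ j' → ∃ i, 2 * δ ≤ |a j i - a j' i|)
    (hcube : ∀ j, cap s δ (a j) ⊆ cube (k + 1)) (w : J → Bool) (j : J) :
    symmDiff (cappedBody s δ a w) (cappedBody s δ a (Function.update w j (!w j))) =
      cap s δ (a j) := by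
  have key : ∀ w w' : J → Bool, w j = true → w' j = false → (∀ j', j' ≠ j → w j' = w' j') →
      symmDiff (cappedBody s δ a w) (cappedBody s δ a w') = cap s δ (a j) := by
    intro w w' hw hw' hww'
    ext x
    rw [mem_symmDiff]
    constructor
    · rintro (⟨h1, h2⟩ | ⟨h1, h2⟩)
      · refine ⟨h1.2.1, ?_⟩
        by_contra hcon
        refine h2 ⟨h1.1, h1.2.1, fun j' hj' => ?_⟩
        by_cases hjj : j' = j
        · subst hjj
          exact not_lt.1 hcon
        · exact h1.2.2 j' ((hww' j' hjj).trans hj')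
      · refine absurd ⟨h1.1, h1.2.1, fun j' hj' => ?_⟩ h2
        have hjj : j' ≠ j := by
          rintro rfl
          simp [hw] at hj'
        exact h1.2.2 j' ((hww' j' hjj).symm.trans hj')
    · intro hx
      refine Or.inl ⟨⟨hcube j hx, hx.1, fun j' hj' => ?_⟩, fun h => (h.2.2 j hw').not_gt hx.2⟩
      have hjj : j ≠ j' := by
        rintro rfl
        simp [hw] at hj'
      obtain ⟨i, hi⟩ := hsep j j' hjj
      have := le_baseDistSq_of_mem_cap hs hδ hi hx
      exact hx.1.trans (mul_nonneg hs.le (sub_nonneg.2 this))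
  by_cases hw : w j = true
  · exact key _ _ hw (by simp [hw]) fun j' hj' => by simp [hj']
  · rw [symmDiff_comm]
    exact key _ _ (by simp [hw]) (by simpa using hw) fun j' hj' => by simp [hj']

lemma volume_cap_le {k : ℕ} {s δ : ℝ} (hs : 0 < s) (hδ : 0 < δ) (a : Fin k → ℝ) :
    volume (cap s δ a) ≤ ENNReal.ofReal ((2 * δ) ^ k * (s * δ ^ 2)) := by
  rw [ENNReal.ofReal_mul (by positivity), ENNReal.ofReal_pow (by positivity), ← volume_box a,
    ← volume_graph_slab (φ := fun y => 1 - s * ∑ i, y i ^ 2) (by fun_prop) (measurableSet_box a δ)]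
  refine measure_mono fun x hx => ?_
  have hb : 0 ≤ baseDistSq a x := Finset.sum_nonneg fun i _ => sq_nonneg _
  refine ⟨fun i => (abs_sub_lt_of_mem_cap hs hδ hx i).le, ?_, ?_⟩
  · have := hx.2
    rw [paraboloid] at this
    nlinarith
  · have := hx.1
    rw [paraboloid] at this
    linarith

lemma le_volume_cap {k : ℕ} (hk : 1 ≤ k) {s δ : ℝ} (hs : 0 < s) (hδ : 0 < δ) (a : Fin k → ℝ) :
    ENNReal.ofReal ((δ / k) ^ k * (s * δ ^ 2 / 2)) ≤ volume (cap s δ a) := by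
  have hk' : (1:ℝ) ≤ k := by exact_mod_cast hk
  have e : δ / k = 2 * (δ / (2 * k)) := by field_simp
  rw [e, ENNReal.ofReal_mul (by positivity), ENNReal.ofReal_pow (by positivity), ← volume_box a,
    ← volume_graph_slab (φ := fun y => 1 - s * ∑ i, y i ^ 2) (by fun_prop)
      (measurableSet_box a (δ / (2 * k)))]
  refine measure_mono ?_
  rintro x ⟨hB, h1, h2⟩
  have hb : baseDistSq a x ≤ δ ^ 2 / 2 := by
    calc baseDistSq a x ≤ ∑ _i : Fin k, (δ / (2 * k)) ^ 2 := by
          refine Finset.sum_le_sum fun i _ => ?_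
          rw [← sq_abs]
          exact pow_le_pow_left₀ (abs_nonneg _) (hB i) 2
      _ = δ ^ 2 / (4 * k) := by
          simp only [Finset.sum_const, Finset.card_univ, Fintype.card_fin, nsmul_eq_mul]
          field_simp
          norm_num
      _ ≤ δ ^ 2 / 2 := by
          gcongr
          linarith
  simp only [cap, mem_ofPred_eq, paraboloid]
  constructor
  · linarith
  · nlinarith [mul_le_mul_of_nonneg_left hb hs.le]

lemma half_le_volume_compl_pow {d n : ℕ} (hn : 1 ≤ n) {D : Set (EuclideanSpace ℝ (Fin d))}
    (hD : volume D ≤ ENNReal.ofReal (1 / (4 * n))) :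
    ENNReal.ofReal (1 / 2) ≤ volume (Dᶜ ∩ cube d) ^ n := by
  have hn' : (1:ℝ) ≤ n := by exact_mod_cast hn
  have hsmall : 1 / (4 * (n:ℝ)) ≤ 1 := by
    rw [div_le_one (by positivity)]
    linarith
  have h1 : ENNReal.ofReal (1 - 1 / (4 * n)) ≤ volume (Dᶜ ∩ cube d) := by
    rw [ENNReal.ofReal_sub _ (by positivity), ENNReal.ofReal_one, tsub_le_iff_left]
    calc (1:ENNReal) = volume (cube d) := (volume_cube d).symm
      _ ≤ volume (D ∪ (Dᶜ ∩ cube d)) := measure_mono fun x hx => by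
          by_cases h : x ∈ D <;> simp [h, hx]
      _ ≤ volume D + volume (Dᶜ ∩ cube d) := measure_union_le _ _
      _ ≤ _ := by gcongr
  calc ENNReal.ofReal (1 / 2) ≤ ENNReal.ofReal ((1 - 1 / (4 * n)) ^ n) := by
        refine ENNReal.ofReal_le_ofReal ?_
        have := one_add_mul_le_pow (a := -(1 / (4 * (n:ℝ)))) (by linarith) n
        have e : (n:ℝ) * -(1 / (4 * (n:ℝ))) = -(1 / 4) := by field_simp
        rw [e] at this
        rw [sub_eq_add_neg]
        linarith
    _ = ENNReal.ofReal (1 - 1 / (4 * n)) ^ n := ENNReal.ofReal_pow (by linarith) n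
    _ ≤ _ := by gcongr

/-- Centre of the cell with multi-index `j` in the grid of `M ^ k` cells of `[0,1]^k`. -/
def gridCenter {k M : ℕ} (j : Fin k → Fin M) (i : Fin k) : ℝ :=
  (2 * ((j i : ℕ) : ℝ) + 1) * (1 / (2 * (M:ℝ)))

lemma gridCenter_mem_Icc {k M : ℕ} (hM : 1 ≤ M) (j : Fin k → Fin M) (i : Fin k) :
    gridCenter j i ∈ Icc (1 / (2 * (M:ℝ))) (1 - 1 / (2 * (M:ℝ))) := by
  have hM' : (1:ℝ) ≤ M := by exact_mod_cast hM
  have hj : ((j i : ℕ) : ℝ) + 1 ≤ M := by exact_mod_cast (j i).2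
  have hpos : 0 < 1 / (2 * (M:ℝ)) := by positivity
  have e : 2 * (M:ℝ) * (1 / (2 * (M:ℝ))) = 1 := by field_simp
  have h0 : (0:ℝ) ≤ ((j i : ℕ) : ℝ) := by positivity
  unfold gridCenter
  constructor <;> nlinarith [mul_nonneg h0 hpos.le]

lemma gridCenter_separated {k M : ℕ} {j j' : Fin k → Fin M} (h : j ≠ j') :
    ∃ i, 2 * (1 / (2 * (M:ℝ))) ≤ |gridCenter j i - gridCenter j' i| := by
  obtain ⟨i, hi⟩ := Function.ne_iff.1 h
  refine ⟨i, ?_⟩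
  have e : gridCenter j i - gridCenter j' i =
      2 * (1 / (2 * (M:ℝ))) * ((((j i : ℕ) : ℤ) - ((j' i : ℕ) : ℤ) : ℤ) : ℝ) := by
    unfold gridCenter
    push_cast
    ring
  have hz : (((j i : ℕ) : ℤ) - ((j' i : ℕ) : ℤ)) ≠ 0 := by
    have := Fin.val_ne_of_ne hi
    omega
  have h1 : (1:ℝ) ≤ |((((j i : ℕ) : ℤ) - ((j' i : ℕ) : ℤ) : ℤ) : ℝ)| := by
    exact_mod_cast Int.one_le_abs hz
  have hp : (0:ℝ) ≤ 2 * (1 / (2 * (M:ℝ))) := by positivity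
  rw [e, abs_mul, abs_of_nonneg hp]
  exact le_mul_of_one_le_right hp h1

lemma exists_grid_size (k n : ℕ) (hn : 1 ≤ n) :
    ∃ M : ℕ, 1 ≤ M ∧ (n:ℝ) ≤ (M:ℝ) ^ (k + 2) ∧
      (n:ℝ) ^ (-(2:ℝ) / ((k:ℝ) + 2)) ≤ 4 / (M:ℝ) ^ 2 := by
  have hn' : (1:ℝ) ≤ n := by exact_mod_cast hn
  have hn0 : (0:ℝ) ≤ n := by linarith
  set x : ℝ := (n:ℝ) ^ (1 / ((k:ℝ) + 2)) with hx
  have hx1 : 1 ≤ x := Real.one_le_rpow hn' (by positivity)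
  have hceil : x ≤ ⌈x⌉₊ := Nat.le_ceil x
  have hxM : (⌈x⌉₊ : ℝ) ≤ 2 * x := by
    have := Nat.ceil_lt_add_one (zero_le_one.trans hx1)
    linarith
  have hM0 : (0:ℝ) < ⌈x⌉₊ := by linarith
  refine ⟨⌈x⌉₊, Nat.one_le_ceil_iff.2 (by linarith), ?_, ?_⟩
  · have : (n:ℝ) = x ^ (k + 2) := by
      rw [hx, ← Real.rpow_natCast, ← Real.rpow_mul hn0]
      push_cast
      rw [one_div_mul_cancel (by positivity), Real.rpow_one]
    calc (n:ℝ) = x ^ (k + 2) := this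
      _ ≤ _ := by gcongr
  · have e : (n:ℝ) ^ (-(2:ℝ) / ((k:ℝ) + 2)) = 1 / x ^ 2 := by
      rw [hx, ← Real.rpow_natCast, ← Real.rpow_mul hn0, one_div, ← Real.rpow_neg hn0]
      congr 1
      push_cast
      ring
    rw [e, div_le_div_iff₀ (by positivity) (by positivity)]
    nlinarith

/-- **Theorem 4** : minimax lower bound of order `n^{-2/(d+1)}` on the class `𝒞_d`
of compact convex subsets of the cube, with Gaussian noise. -/
theorem minimax_lower_convex (d : ℕ) (hd : 2 ≤ d) (σ : ℝ) (hσ : 0 < σ) :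
    ∃ C₁₇ : ℝ, 0 < C₁₇ ∧ ∀ n : ℕ, 125 ≤ n →
      ∀ hatC : (Fin n → EuclideanSpace ℝ (Fin d) × ℝ) → Set (EuclideanSpace ℝ (Fin d)),
        IsSetEstimator d n hatC →
        ENNReal.ofReal (C₁₇ * (n:ℝ) ^ (-(2:ℝ) / ((d:ℝ) + 1)))
          ≤ ⨆ C ∈ convexSets d,
              ∫⁻ ω, volume (symmDiff C (hatC ω))
                ∂ sampleLaw d n (gaussianReal 0 (Real.toNNReal (σ^2))) C := by
  obtain ⟨k, rfl⟩ : ∃ k, d = k + 1 := ⟨d - 1, by omega⟩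
  have hk : 1 ≤ k := by omega
  have hk' : (1:ℝ) ≤ k := by exact_mod_cast hk
  set s : ℝ := 1 / ((k:ℝ) + 1) with hs_def
  have hs : 0 < s := by positivity
  have hs1 : s ≤ 1 := by
    rw [hs_def, div_le_one (by positivity)]
    linarith
  refine ⟨(1 / (2 * k)) ^ k * s / 128, by positivity, fun n hn hatC hC => ?_⟩
  have hn1 : 1 ≤ n := by omega
  have hn' : (1:ℝ) ≤ n := by exact_mod_cast hn1
  obtain ⟨M, hM, hMn, hnM⟩ := exists_grid_size k n hn1
  have hM' : (1:ℝ) ≤ M := by exact_mod_cast hM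
  set δ : ℝ := 1 / (2 * (M:ℝ)) with hδ_def
  have hδ : 0 < δ := by positivity
  have hδ1 : δ ≤ 1 := by
    rw [hδ_def, div_le_one (by positivity)]
    linarith
  have hcube : ∀ j : Fin k → Fin M, cap s δ (gridCenter j) ⊆ cube (k + 1) := fun j =>
    cap_subset_cube hδ hδ1 (gridCenter_mem_Icc hM j)
  have hmem := fun w : (Fin k → Fin M) → Bool =>
    cappedBody_mem_convexSets hs.le δ (gridCenter (k := k) (M := M)) w
  have hsmall : ∀ j : Fin k → Fin M,
      volume (cap s δ (gridCenter j)) ≤ ENNReal.ofReal (1 / (4 * n)) := fun j => by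
    refine (volume_cap_le hs hδ _).trans (ENNReal.ofReal_le_ofReal ?_)
    calc (2 * δ) ^ k * (s * δ ^ 2) ≤ (2 * δ) ^ k * (1 * δ ^ 2) := by gcongr
      _ = 1 / (4 * (M:ℝ) ^ (k + 2)) := by
          rw [hδ_def, show 2 * (1 / (2 * (M:ℝ))) = 1 / M by field_simp, div_pow, div_pow]
          field_simp
          ring
      _ ≤ 1 / (4 * n) := by gcongr
  have hassouad := assouad_bound (ν := gaussianReal 0 (Real.toNNReal (σ ^ 2))) hC
    (C := cappedBody s δ (gridCenter (k := k) (M := M))) (D := fun j => cap s δ (gridCenter j))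
    (L := ENNReal.ofReal ((δ / k) ^ k * (s * δ ^ 2 / 2) * (1 / 2)))
    (fun w => (hmem w).2.1.measurableSet)
    (fun j j' hjj => (gridCenter_separated hjj).elim fun i hi => cap_disjoint hs hδ hi)
    (symmDiff_cappedBody hs hδ (fun j j' hjj => gridCenter_separated hjj) hcube)
    (fun j => by
      rw [ENNReal.ofReal_mul (by positivity)]
      exact mul_le_mul' (le_volume_cap hk hs hδ _) (half_le_volume_compl_pow hn1 (hsmall j)))
    (fun w => le_iSup₂ (f := fun C (_ : C ∈ convexSets (k + 1)) =>
      ∫⁻ ω, volume (symmDiff C (hatC ω))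
        ∂ sampleLaw (k + 1) n (gaussianReal 0 (Real.toNNReal (σ ^ 2))) C) _ (hmem w))
  have htwo : (2:ENNReal) = ENNReal.ofReal 2 := by simp
  rw [← ENNReal.mul_le_mul_iff_right two_ne_zero ENNReal.ofNat_ne_top]
  refine le_trans ?_ hassouad
  have hcard : (Fintype.card (Fin k → Fin M) : ENNReal) = ENNReal.ofReal ((M:ℝ) ^ k) := by
    rw [ENNReal.ofReal_pow (by positivity), ENNReal.ofReal_natCast]
    simp
  rw [hcard, htwo, ← ENNReal.ofReal_mul (by positivity), ← ENNReal.ofReal_mul (by positivity)]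
  refine ENNReal.ofReal_le_ofReal ?_
  have hexp : (((k + 1 : ℕ) : ℝ) + 1) = (k:ℝ) + 2 := by
    push_cast
    ring
  rw [hexp]
  have e : (M:ℝ) ^ k * ((δ / k) ^ k * (s * δ ^ 2 / 2) * (1 / 2)) =
      2 * ((1 / (2 * k)) ^ k * s / 128 * (4 / (M:ℝ) ^ 2)) := by
    have h1 : (M:ℝ) ^ k * (δ / k) ^ k = (1 / (2 * k)) ^ k := by
      rw [← mul_pow, hδ_def]
      congr 1
      field_simp
    have h2 : δ ^ 2 = 1 / (4 * (M:ℝ) ^ 2) := by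
      rw [hδ_def, div_pow, mul_pow]
      norm_num
    calc _ = ((M:ℝ) ^ k * (δ / k) ^ k) * (s * δ ^ 2 / 4) := by ring
      _ = _ := by
        rw [h1, h2]
        field_simp
        norm_num
  rw [e]
  gcongr
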